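/- arXiv:2109.02144 — 2 statements merged into one kernel-verified Lean document; each statement's English description precedes it below -/
import Mathlib

section
/- Let B be a bicategory and D a category. If (α₀, α₁, α₂) : C → C′ is a morphism of B-cocones valued in D (a pseudonatural transformation restricting to the identity on the 2-truncated cyclic bar diagram, with components α₀, α₁, α₂ between the respective legs), then the natural transformation α₀ : C₀ ⇒ C₀′ is a morphism of shadows from (C₀, θ_C) to (C₀′, θ_{C′}): it satisfies θ_{C′} ∘ (α₀ ∗ d₀) = (α₀ ∗ d₁) ∘ θ_C and commutes with the images of the associators and unitors of B under the two shadow functors. -/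
open CategoryTheory Bicategory

universe w v u v' u'

variable (B : Type u) [Bicategory.{w, v} B] (D : Type u') [Category.{v'} D]

/-- A `B`-cocone valued in `D`: a pseudofunctor `((Δ_{≤2})ᵒᵖ)^▷ ⥤ Cat` restricting on
`(Δ_{≤2})ᵒᵖ` to the 2-truncated cyclic bar diagram of the bicategory `B` and sending the
adjoined terminal object to `D`.  Following the computadic description of pseudofunctors
on the 2-truncated simplex category (as in the appendix of the paper), such a pseudofunctor
is specified by its legs `C₀, C₁, C₂` over `[0], [1], [2]` together with natural structure
isomorphisms over each generating face (`d₀, d₁ : [1] → [0]`, `d₀, d₁, d₂ : [2] → [1]`) and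
degeneracy (`s₀ : [0] → [1]`, `s₀, s₁ : [1] → [2]`) of `(Δ_{≤2})ᵒᵖ`, which satisfy a
compatibility (cocone) condition over each of the generating relations of `(Δ_{≤2})ᵒᵖ`,
the comparison between the two sides of a relation being given by the associators and
unitors of `B` (the pseudofunctoriality constraints of the cyclic bar diagram).

Here the 2-truncated cyclic bar diagram has levels
`N₀ = ∐_X B(X,X)`, `N₁ = ∐_{X,Y} B(X,Y) × B(Y,X)`,
`N₂ = ∐_{X,Y,Z} B(X,Y) × B(Y,Z) × B(Z,X)` (all levels given componentwise below),
with faces given by horizontal composition of adjacent factors (the last face composing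
after a cyclic rotation) and degeneracies inserting identity 1-cells. -/
structure BarCocone where
  /-- the leg over `[0]`, on each component of `N₀ = ∐_X B(X,X)` -/
  C₀ : ∀ X : B, (X ⟶ X) ⥤ D
  /-- the leg over `[1]`, on each component of `N₁ = ∐_{X,Y} B(X,Y) × B(Y,X)` -/
  C₁ : ∀ X Y : B, ((X ⟶ Y) × (Y ⟶ X)) ⥤ D
  /-- the leg over `[2]`, on each component of `N₂ = ∐_{X,Y,Z} B(X,Y) × B(Y,Z) × B(Z,X)` -/
  C₂ : ∀ X Y Z : B, ((X ⟶ Y) × ((Y ⟶ Z) × (Z ⟶ X))) ⥤ D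
  /-- structure isomorphism over the face `d₀ : [1] → [0]`, `(F,G) ↦ F∗G` -/
  lam₀ : ∀ {X Y : B} (F : X ⟶ Y) (G : Y ⟶ X),
    (C₀ X).obj (F ≫ G) ≅ (C₁ X Y).obj (F, G)
  /-- structure isomorphism over the face `d₁ : [1] → [0]`, `(F,G) ↦ G∗F` -/
  lam₁ : ∀ {X Y : B} (F : X ⟶ Y) (G : Y ⟶ X),
    (C₀ Y).obj (G ≫ F) ≅ (C₁ X Y).obj (F, G)
  lam₀_natural :
    ∀ {X Y : B} {F F' : X ⟶ Y} {G G' : Y ⟶ X} (α : F ⟶ F') (β : G ⟶ G'),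
      (C₀ X).map (α ▷ G ≫ F' ◁ β) ≫ (lam₀ F' G').hom =
        (lam₀ F G).hom ≫ (C₁ X Y).map (α, β)
  lam₁_natural :
    ∀ {X Y : B} {F F' : X ⟶ Y} {G G' : Y ⟶ X} (α : F ⟶ F') (β : G ⟶ G'),
      (C₀ Y).map (β ▷ F ≫ G' ◁ α) ≫ (lam₁ F' G').hom =
        (lam₁ F G).hom ≫ (C₁ X Y).map (α, β)
  /-- structure isomorphism over the face `d₀ : [2] → [1]`, `(F,G,H) ↦ (F∗G, H)` -/
  mu₀ : ∀ {X Y Z : B} (F : X ⟶ Y) (G : Y ⟶ Z) (H : Z ⟶ X),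
    (C₁ X Z).obj (F ≫ G, H) ≅ (C₂ X Y Z).obj (F, G, H)
  /-- structure isomorphism over the face `d₁ : [2] → [1]`, `(F,G,H) ↦ (F, G∗H)` -/
  mu₁ : ∀ {X Y Z : B} (F : X ⟶ Y) (G : Y ⟶ Z) (H : Z ⟶ X),
    (C₁ X Y).obj (F, G ≫ H) ≅ (C₂ X Y Z).obj (F, G, H)
  /-- structure isomorphism over the (cyclically rotated) face `d₂ : [2] → [1]`,
  `(F,G,H) ↦ (H∗F, G)` -/
  mu₂ : ∀ {X Y Z : B} (F : X ⟶ Y) (G : Y ⟶ Z) (H : Z ⟶ X),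
    (C₁ Z Y).obj (H ≫ F, G) ≅ (C₂ X Y Z).obj (F, G, H)
  mu₀_natural :
    ∀ {X Y Z : B} {F F' : X ⟶ Y} {G G' : Y ⟶ Z} {H H' : Z ⟶ X}
      (α : F ⟶ F') (β : G ⟶ G') (γ : H ⟶ H'),
      (C₁ X Z).map (α ▷ G ≫ F' ◁ β, γ) ≫ (mu₀ F' G' H').hom =
        (mu₀ F G H).hom ≫ (C₂ X Y Z).map (α, β, γ)
  mu₁_natural :
    ∀ {X Y Z : B} {F F' : X ⟶ Y} {G G' : Y ⟶ Z} {H H' : Z ⟶ X}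
      (α : F ⟶ F') (β : G ⟶ G') (γ : H ⟶ H'),
      (C₁ X Y).map (α, β ▷ H ≫ G' ◁ γ) ≫ (mu₁ F' G' H').hom =
        (mu₁ F G H).hom ≫ (C₂ X Y Z).map (α, β, γ)
  mu₂_natural :
    ∀ {X Y Z : B} {F F' : X ⟶ Y} {G G' : Y ⟶ Z} {H H' : Z ⟶ X}
      (α : F ⟶ F') (β : G ⟶ G') (γ : H ⟶ H'),
      (C₁ Z Y).map (γ ▷ F ≫ H' ◁ α, β) ≫ (mu₂ F' G' H').hom =
        (mu₂ F G H).hom ≫ (C₂ X Y Z).map (α, β, γ)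
  /-- structure isomorphism over the degeneracy `s₀ : [0] → [1]`, `K ↦ (K, U_X)` -/
  sig : ∀ {X : B} (K : X ⟶ X), (C₁ X X).obj (K, 𝟙 X) ≅ (C₀ X).obj K
  sig_natural :
    ∀ {X : B} {K K' : X ⟶ X} (κ : K ⟶ K'),
      (C₁ X X).map (κ, 𝟙 (𝟙 X)) ≫ (sig K').hom = (sig K).hom ≫ (C₀ X).map κ
  /-- structure isomorphism over the degeneracy `s₀ : [1] → [2]`, `(F,G) ↦ (F, U_Y, G)` -/
  tau₀ : ∀ {X Y : B} (F : X ⟶ Y) (G : Y ⟶ X),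
    (C₂ X Y Y).obj (F, 𝟙 Y, G) ≅ (C₁ X Y).obj (F, G)
  /-- structure isomorphism over the degeneracy `s₁ : [1] → [2]`, `(F,G) ↦ (F, G, U_X)` -/
  tau₁ : ∀ {X Y : B} (F : X ⟶ Y) (G : Y ⟶ X),
    (C₂ X Y X).obj (F, G, 𝟙 X) ≅ (C₁ X Y).obj (F, G)
  tau₀_natural :
    ∀ {X Y : B} {F F' : X ⟶ Y} {G G' : Y ⟶ X} (α : F ⟶ F') (β : G ⟶ G'),
      (C₂ X Y Y).map (α, 𝟙 (𝟙 Y), β) ≫ (tau₀ F' G').hom =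
        (tau₀ F G).hom ≫ (C₁ X Y).map (α, β)
  tau₁_natural :
    ∀ {X Y : B} {F F' : X ⟶ Y} {G G' : Y ⟶ X} (α : F ⟶ F') (β : G ⟶ G'),
      (C₂ X Y X).map (α, β, 𝟙 (𝟙 X)) ≫ (tau₁ F' G').hom =
        (tau₁ F G).hom ≫ (C₁ X Y).map (α, β)
  /-- cocone compatibility over the simplicial relation `d₀ ∘ d₀ = d₀ ∘ d₁ : [2] → [0]`,
  whose two sides are compared via the associator of `B` -/
  coh_a₀ :
    ∀ {X Y Z : B} (F : X ⟶ Y) (G : Y ⟶ Z) (H : Z ⟶ X),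
      (lam₀ (F ≫ G) H).hom ≫ (mu₀ F G H).hom =
        (C₀ X).map (α_ F G H).hom ≫ (lam₀ F (G ≫ H)).hom ≫ (mu₁ F G H).hom
  /-- cocone compatibility over the simplicial relation `d₀ ∘ d₂ = d₁ ∘ d₀ : [2] → [0]` -/
  coh_a₁ :
    ∀ {X Y Z : B} (F : X ⟶ Y) (G : Y ⟶ Z) (H : Z ⟶ X),
      (C₀ Z).map (α_ H F G).hom ≫ (lam₁ (F ≫ G) H).hom ≫ (mu₀ F G H).hom =
        (lam₀ (H ≫ F) G).hom ≫ (mu₂ F G H).hom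
  /-- cocone compatibility over the simplicial relation `d₁ ∘ d₁ = d₁ ∘ d₂ : [2] → [0]` -/
  coh_a₂ :
    ∀ {X Y Z : B} (F : X ⟶ Y) (G : Y ⟶ Z) (H : Z ⟶ X),
      (lam₁ F (G ≫ H)).hom ≫ (mu₁ F G H).hom =
        (C₀ Y).map (α_ G H F).hom ≫ (lam₁ (H ≫ F) G).hom ≫ (mu₂ F G H).hom
  /-- cocone compatibility over the relation `d₀ ∘ s₀ = id : [0] → [0]`,
  mediated by the right unitor of `B` -/
  coh_s₀ :
    ∀ {X : B} (K : X ⟶ X),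
      (lam₀ K (𝟙 X)).hom ≫ (sig K).hom = (C₀ X).map (ρ_ K).hom
  /-- cocone compatibility over the relation `d₁ ∘ s₀ = id : [0] → [0]`,
  mediated by the left unitor of `B` -/
  coh_s₁ :
    ∀ {X : B} (K : X ⟶ X),
      (lam₁ K (𝟙 X)).hom ≫ (sig K).hom = (C₀ X).map (λ_ K).hom
  /-- cocone compatibility over the relation `d₀ ∘ s₀ = id : [1] → [1]` -/
  coh_t₀ :
    ∀ {X Y : B} (F : X ⟶ Y) (G : Y ⟶ X),
      (mu₀ F (𝟙 Y) G).hom ≫ (tau₀ F G).hom = (C₁ X Y).map ((ρ_ F).hom, 𝟙 G)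
  /-- cocone compatibility over the relation `d₁ ∘ s₀ = id : [1] → [1]` -/
  coh_t₁ :
    ∀ {X Y : B} (F : X ⟶ Y) (G : Y ⟶ X),
      (mu₁ F (𝟙 Y) G).hom ≫ (tau₀ F G).hom = (C₁ X Y).map (𝟙 F, (λ_ G).hom)
  /-- cocone compatibility over the relation `d₁ ∘ s₁ = id : [1] → [1]` -/
  coh_t₂ :
    ∀ {X Y : B} (F : X ⟶ Y) (G : Y ⟶ X),
      (mu₁ F G (𝟙 X)).hom ≫ (tau₁ F G).hom = (C₁ X Y).map (𝟙 F, (ρ_ G).hom)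
  /-- cocone compatibility over the relation `d₂ ∘ s₁ = id : [1] → [1]` -/
  coh_t₃ :
    ∀ {X Y : B} (F : X ⟶ Y) (G : Y ⟶ X),
      (mu₂ F G (𝟙 X)).hom ≫ (tau₁ F G).hom = (C₁ X Y).map ((λ_ F).hom, 𝟙 G)
  /-- cocone compatibility over the relation `s₀ ∘ s₀ = s₁ ∘ s₀ : [0] → [2]` -/
  coh_d :
    ∀ {X : B} (K : X ⟶ X), (tau₀ K (𝟙 X)).hom = (tau₁ K (𝟙 X)).hom

variable {B D}

/-- The canonical isomorphism `θ_C : C₀ ∘ d₀ ≅ C₁ ≅ C₀ ∘ d₁` associated to a `B`-cocone,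
the composite of the two structure isomorphisms over the faces `d₀, d₁ : [1] → [0]`. -/
def BarCocone.theta (C : BarCocone B D) {X Y : B} (F : X ⟶ Y) (G : Y ⟶ X) :
    (C.C₀ X).obj (F ≫ G) ≅ (C.C₀ Y).obj (G ≫ F) :=
  (C.lam₀ F G).trans (C.lam₁ F G).symm

/-- A morphism of `B`-cocones valued in `D`: a pseudonatural transformation
`(α₀, α₁, α₂)` restricting to the identity on the 2-truncated cyclic bar diagram of `B`
(so with identity component at the cone point), i.e. natural transformations between the
respective legs that strictly commute with all the structure isomorphisms. -/
@[ext]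
structure BarCoconeHom (C C' : BarCocone B D) where
  /-- the component between the legs over `[0]` -/
  α₀ : ∀ X : B, C.C₀ X ⟶ C'.C₀ X
  /-- the component between the legs over `[1]` -/
  α₁ : ∀ X Y : B, C.C₁ X Y ⟶ C'.C₁ X Y
  /-- the component between the legs over `[2]` -/
  α₂ : ∀ X Y Z : B, C.C₂ X Y Z ⟶ C'.C₂ X Y Z
  wlam₀ : ∀ {X Y : B} (F : X ⟶ Y) (G : Y ⟶ X),
    (C.lam₀ F G).hom ≫ (α₁ X Y).app (F, G) = (α₀ X).app (F ≫ G) ≫ (C'.lam₀ F G).hom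
  wlam₁ : ∀ {X Y : B} (F : X ⟶ Y) (G : Y ⟶ X),
    (C.lam₁ F G).hom ≫ (α₁ X Y).app (F, G) = (α₀ Y).app (G ≫ F) ≫ (C'.lam₁ F G).hom
  wmu₀ : ∀ {X Y Z : B} (F : X ⟶ Y) (G : Y ⟶ Z) (H : Z ⟶ X),
    (C.mu₀ F G H).hom ≫ (α₂ X Y Z).app (F, G, H) =
      (α₁ X Z).app (F ≫ G, H) ≫ (C'.mu₀ F G H).hom
  wmu₁ : ∀ {X Y Z : B} (F : X ⟶ Y) (G : Y ⟶ Z) (H : Z ⟶ X),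
    (C.mu₁ F G H).hom ≫ (α₂ X Y Z).app (F, G, H) =
      (α₁ X Y).app (F, G ≫ H) ≫ (C'.mu₁ F G H).hom
  wmu₂ : ∀ {X Y Z : B} (F : X ⟶ Y) (G : Y ⟶ Z) (H : Z ⟶ X),
    (C.mu₂ F G H).hom ≫ (α₂ X Y Z).app (F, G, H) =
      (α₁ Z Y).app (H ≫ F, G) ≫ (C'.mu₂ F G H).hom
  wsig : ∀ {X : B} (K : X ⟶ X),
    (C.sig K).hom ≫ (α₀ X).app K = (α₁ X X).app (K, 𝟙 X) ≫ (C'.sig K).hom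
  wtau₀ : ∀ {X Y : B} (F : X ⟶ Y) (G : Y ⟶ X),
    (C.tau₀ F G).hom ≫ (α₁ X Y).app (F, G) =
      (α₂ X Y Y).app (F, 𝟙 Y, G) ≫ (C'.tau₀ F G).hom
  wtau₁ : ∀ {X Y : B} (F : X ⟶ Y) (G : Y ⟶ X),
    (C.tau₁ F G).hom ≫ (α₁ X Y).app (F, G) =
      (α₂ X Y X).app (F, G, 𝟙 X) ≫ (C'.tau₁ F G).hom

/-- If `(α₀, α₁, α₂) : C → C'` is a morphism of `B`-cocones valued in
`D`, then the natural transformation `α₀ : C₀ ⟶ C₀'` is a morphism of shadows from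
`(C₀, θ_C)` to `(C₀', θ_{C'})`: it satisfies
`θ_{C'} ∘ (α₀ ∗ d₀) = (α₀ ∗ d₁) ∘ θ_C`, and it commutes with the images of the
associators and unitors of `B` under the two shadow functors. -/
theorem barCoconeHom_is_shadow_morphism {C C' : BarCocone B D} (f : BarCoconeHom C C') :
    -- the compatibility square with the cyclicity isomorphisms
    (∀ {X Y : B} (F : X ⟶ Y) (G : Y ⟶ X),
      (f.α₀ X).app (F ≫ G) ≫ (C'.theta F G).hom =
        (C.theta F G).hom ≫ (f.α₀ Y).app (G ≫ F)) ∧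
    -- `α₀` commutes with the images of the associators
    (∀ {X Y Z : B} (F : X ⟶ Y) (G : Y ⟶ Z) (H : Z ⟶ X),
      (f.α₀ X).app ((F ≫ G) ≫ H) ≫ (C'.C₀ X).map (α_ F G H).hom =
        (C.C₀ X).map (α_ F G H).hom ≫ (f.α₀ X).app (F ≫ G ≫ H)) ∧
    -- `α₀` commutes with the images of the left unitors
    (∀ {X : B} (K : X ⟶ X),
      (f.α₀ X).app (𝟙 X ≫ K) ≫ (C'.C₀ X).map (λ_ K).hom =
        (C.C₀ X).map (λ_ K).hom ≫ (f.α₀ X).app K) ∧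
    -- `α₀` commutes with the images of the right unitors
    (∀ {X : B} (K : X ⟶ X),
      (f.α₀ X).app (K ≫ 𝟙 X) ≫ (C'.C₀ X).map (ρ_ K).hom =
        (C.C₀ X).map (ρ_ K).hom ≫ (f.α₀ X).app K) := by
  refine ⟨fun {X Y} F G => ?_, fun F G H => ((f.α₀ _).naturality (α_ F G H).hom).symm,
    fun K => ((f.α₀ _).naturality (λ_ K).hom).symm,
    fun K => ((f.α₀ _).naturality (ρ_ K).hom).symm⟩
  have h : (f.α₁ X Y).app (F, G) ≫ (C'.lam₁ F G).inv =
      (C.lam₁ F G).inv ≫ (f.α₀ Y).app (G ≫ F) := by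
    rw [Iso.comp_inv_eq, Category.assoc, Iso.eq_inv_comp, f.wlam₁]
  simp only [BarCocone.theta, Iso.trans_hom, Iso.symm_hom, Category.assoc]
  rw [← Category.assoc, ← f.wlam₀, Category.assoc, h]
end

section
/- Let B be a bicategory, D a category, and (⟨−⟩, θ) a shadow on B with values in D. Then there exists a B-cocone C valued in D whose leg over [0] is C₀ = ⟨−⟩ and whose composite structure isomorphism C₀∘d₀ ≅ C₁ ≅ C₀∘d₁ over the faces d₀, d₁ : [1] → [0] equals θ. In other words, every shadow on B valued in D extends to a pseudofunctor cocone under the 2-truncated cyclic bar diagram of B with vertex D. -/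
open CategoryTheory Bicategory

universe w v u v' u'

variable (B : Type u) [Bicategory.{w, v} B] (D : Type u') [Category.{v'} D]

variable {B D}

variable (B D) in
/-- A shadow on a bicategory `B` with values in a category `D` (Campbell–Ponto):
a functor `⟨-⟩ : ∐_X B(X,X) ⥤ D` (given as a family of functors on the endo-hom
categories), together with natural isomorphisms `θ : ⟨F ≫ G⟩ ≅ ⟨G ≫ F⟩` satisfying
the cyclicity (hexagon) axiom with the associators and the unit axiom with the
unitors of `B`. -/
structure Shadow where
  /-- the underlying shadow functor, on each component `B(X,X)` of the disjoint union -/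
  sh : ∀ X : B, (X ⟶ X) ⥤ D
  /-- the cyclicity isomorphism -/
  θ : ∀ {X Y : B} (F : X ⟶ Y) (G : Y ⟶ X), (sh X).obj (F ≫ G) ≅ (sh Y).obj (G ≫ F)
  θ_natural :
    ∀ {X Y : B} {F F' : X ⟶ Y} {G G' : Y ⟶ X} (α : F ⟶ F') (β : G ⟶ G'),
      (sh X).map (α ▷ G ≫ F' ◁ β) ≫ (θ F' G').hom =
        (θ F G).hom ≫ (sh Y).map (β ▷ F ≫ G' ◁ α)
  θ_hexagon :
    ∀ {X Y Z : B} (F : X ⟶ Y) (G : Y ⟶ Z) (H : Z ⟶ X),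
      (θ (F ≫ G) H).hom ≫ (sh Z).map (α_ H F G).inv =
        (sh X).map (α_ F G H).hom ≫ (θ F (G ≫ H)).hom ≫
          (sh Y).map (α_ G H F).hom ≫ (θ G (H ≫ F)).hom
  θ_unit₁ :
    ∀ {X : B} (K : X ⟶ X),
      (θ (𝟙 X) K).hom ≫ (sh X).map (ρ_ K).hom = (sh X).map (λ_ K).hom
  θ_unit₂ :
    ∀ {X : B} (K : X ⟶ X),
      (θ K (𝟙 X)).hom ≫ (sh X).map (λ_ K).hom = (sh X).map (ρ_ K).hom

namespace Shadow

variable (S : Shadow B D)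

/-- Cyclicity is symmetric: the hexagon with an identity 1-cell and the unit axiom force
`θ` to be its own inverse. -/
theorem θ_hom_comp_θ_hom {X Y : B} (F : X ⟶ Y) (G : Y ⟶ X) :
    (S.θ F G).hom ≫ (S.θ G F).hom = 𝟙 _ := by
  have hex := S.θ_hexagon F G (𝟙 X)
  have unit : (S.θ (F ≫ G) (𝟙 X)).hom =
      (S.sh X).map (ρ_ (F ≫ G)).hom ≫ (S.sh X).map (λ_ (F ≫ G)).inv := by
    rw [← S.θ_unit₂, Category.assoc, ← Functor.map_comp, Iso.hom_inv_id,
      CategoryTheory.Functor.map_id, Category.comp_id]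
  have nat₁ : (S.θ F (G ≫ 𝟙 X)).hom =
      (S.sh X).map (F ◁ (ρ_ G).hom) ≫ (S.θ F G).hom ≫ (S.sh Y).map ((ρ_ G).inv ▷ F) := by
    have h := S.θ_natural (𝟙 F) (ρ_ G).hom
    simp only [id_whiskerRight, whiskerLeft_id, Category.id_comp, Category.comp_id] at h
    rw [reassoc_of% h, ← Functor.map_comp, hom_inv_whiskerRight, CategoryTheory.Functor.map_id,
      Category.comp_id]
  have nat₂ : (S.θ G (𝟙 X ≫ F)).hom =
      (S.sh Y).map (G ◁ (λ_ F).hom) ≫ (S.θ G F).hom ≫ (S.sh X).map ((λ_ F).inv ▷ G) := by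
    have h := S.θ_natural (𝟙 G) (λ_ F).hom
    simp only [id_whiskerRight, whiskerLeft_id, Category.id_comp, Category.comp_id] at h
    rw [reassoc_of% h, ← Functor.map_comp, hom_inv_whiskerRight, CategoryTheory.Functor.map_id,
      Category.comp_id]
  have left : (λ_ (F ≫ G)).inv ≫ (α_ (𝟙 X) F G).inv = (λ_ F).inv ▷ G := by simp
  have right : (α_ F G (𝟙 X)).hom ≫ F ◁ (ρ_ G).hom = (ρ_ (F ≫ G)).hom := by simp
  have middle : (ρ_ G).inv ▷ F ≫ (α_ G (𝟙 X) F).hom ≫ G ◁ (λ_ F).hom = 𝟙 _ := by simp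
  have middle' := congrArg (S.sh Y).map middle
  have right' := congrArg (S.sh X).map right
  have left' := congrArg (S.sh X).map left
  simp only [Functor.map_comp, CategoryTheory.Functor.map_id] at middle' right' left'
  rw [unit, nat₁, nat₂] at hex
  simp only [Category.assoc] at hex
  rw [left', reassoc_of% right', reassoc_of% middle', cancel_epi, ← Category.assoc] at hex
  rw [← cancel_mono ((S.sh X).map ((λ_ F).inv ▷ G)), Category.id_comp, ← hex]

theorem θ_inv {X Y : B} (F : X ⟶ Y) (G : Y ⟶ X) : (S.θ F G).inv = (S.θ G F).hom :=
  Iso.inv_ext (S.θ_hom_comp_θ_hom F G)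

/-- The face isomorphism `⟨(H ∘ F) ∘ G⟩ ≅ ⟨F ∘ (G ∘ H)⟩` rotating the last factor. -/
def rotate {X Y Z : B} (F : X ⟶ Y) (G : Y ⟶ Z) (H : Z ⟶ X) :
    (S.sh Z).obj ((H ≫ F) ≫ G) ≅ (S.sh X).obj (F ≫ G ≫ H) :=
  (S.sh Z).mapIso (α_ H F G) ≪≫ S.θ H (F ≫ G) ≪≫ (S.sh X).mapIso (α_ F G H)

/-- The cocone under the cyclic bar diagram whose legs are the shadows of the composites. -/
def toBarCocone : BarCocone B D where
  C₀ := S.sh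
  C₁ X Y :=
    { obj p := (S.sh X).obj (p.1 ≫ p.2)
      map {p q} f := (S.sh X).map (f.1 ▷ p.2 ≫ q.1 ◁ f.2)
      map_id _ := by simp
      map_comp _ _ := by simp [← Functor.map_comp, whisker_exchange_assoc] }
  C₂ X Y Z :=
    { obj p := (S.sh X).obj (p.1 ≫ p.2.1 ≫ p.2.2)
      map {p q} f := (S.sh X).map (f.1 ▷ (p.2.1 ≫ p.2.2) ≫
        q.1 ◁ (f.2.1 ▷ p.2.2 ≫ q.2.1 ◁ f.2.2))
      map_id _ := by simp
      map_comp _ _ := by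
        rw [← Functor.map_comp]
        congr 1
        simp only [prod_comp, comp_whiskerRight, whiskerLeft_comp, Category.assoc]
        simp only [whisker_exchange_assoc, ← whiskerLeft_comp] }
  lam₀ F G := Iso.refl _
  lam₁ F G := S.θ G F
  lam₀_natural _ _ := by simp
  lam₁_natural α β := by
    have h := S.θ_natural β α
    exact h
  mu₀ F G H := (S.sh _).mapIso (α_ F G H)
  mu₁ F G H := Iso.refl _
  mu₂ F G H := S.rotate F G H
  mu₀_natural α β γ := by
    simp only [Functor.mapIso_hom, ← Functor.map_comp]
    congr 1
    simp
  mu₁_natural α β γ := by simp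
  mu₂_natural {X Y Z F F' G G' H H'} α β γ := by
    have h := S.θ_natural γ (α ▷ G ≫ F' ◁ β)
    have e₁ : ((γ ▷ F ≫ H' ◁ α) ▷ G ≫ (H' ≫ F') ◁ β) ≫ (α_ H' F' G').hom =
        (α_ H F G).hom ≫ γ ▷ (F ≫ G) ≫ H' ◁ (α ▷ G ≫ F' ◁ β) := by simp
    have e₂ : ((α ▷ G ≫ F' ◁ β) ▷ H ≫ (F' ≫ G') ◁ γ) ≫ (α_ F' G' H').hom =
        (α_ F G H).hom ≫ α ▷ (G ≫ H) ≫ F' ◁ (β ▷ H ≫ G' ◁ γ) := by simp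
    simp only [rotate, Iso.trans_hom, Functor.mapIso_hom, Category.assoc]
    rw [← Functor.map_comp_assoc, e₁, Functor.map_comp_assoc, reassoc_of% h,
      ← Functor.map_comp, e₂, Functor.map_comp]
  sig K := (S.sh _).mapIso (ρ_ K)
  sig_natural κ := by simp [← Functor.map_comp]
  tau₀ F G := (S.sh _).mapIso (whiskerLeftIso F (λ_ G))
  tau₁ F G := (S.sh _).mapIso (whiskerLeftIso F (ρ_ G))
  tau₀_natural {X Y F F' G G'} α β := by
    simp only [Functor.mapIso_hom, ← Functor.map_comp]
    congr 1
    simp only [id_whiskerRight, Category.id_comp, Category.assoc, whiskerLeftIso_hom,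
      ← whiskerLeft_comp, leftUnitor_naturality]
    simp only [whiskerLeft_comp, whisker_exchange_assoc]
  tau₁_natural α β := by
    simp only [Functor.mapIso_hom, ← Functor.map_comp]
    congr 1
    simp only [whiskerLeft_id, Category.comp_id, Category.assoc, whiskerLeftIso_hom,
      ← whiskerLeft_comp, rightUnitor_naturality]
    simp only [whiskerLeft_comp, whisker_exchange_assoc]
  coh_a₀ F G H := by simp
  coh_a₁ F G H := by simp [rotate]
  coh_a₂ {X Y Z} F G H := by
    have h := S.θ_hexagon G H F
    simp only [rotate, Iso.refl_hom, Category.comp_id, Iso.trans_hom, Functor.mapIso_hom]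
    rw [← reassoc_of% h, ← Functor.map_comp, Iso.inv_hom_id, CategoryTheory.Functor.map_id,
      Category.comp_id]
  coh_s₀ K := by simp
  coh_s₁ K := S.θ_unit₁ K
  coh_t₀ F G := by simp [← Functor.map_comp]
  coh_t₁ F G := by simp
  coh_t₂ F G := by simp
  coh_t₃ {X Y} F G := by
    have h := S.θ_unit₁ (F ≫ G)
    have e : (α_ F G (𝟙 X)).hom ≫ F ◁ (ρ_ G).hom = (ρ_ (F ≫ G)).hom := by simp
    simp only [rotate, Iso.trans_hom, Functor.mapIso_hom, Category.assoc, whiskerLeftIso_hom]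
    rw [← Functor.map_comp, e, h, ← Functor.map_comp]
    simp
  coh_d K := by simp [unitors_equal]

end Shadow

/-- Every shadow `(⟨-⟩, θ)` on `B` valued in `D` extends to a
`B`-cocone `C` valued in `D` (a pseudofunctor cocone under the 2-truncated cyclic bar
diagram of `B` with vertex `D`), whose leg over `[0]` is `C₀ = ⟨-⟩` and whose composite
structure isomorphism `C₀ ∘ d₀ ≅ C₁ ≅ C₀ ∘ d₁` over the faces `d₀, d₁ : [1] → [0]`
equals `θ`. -/
theorem shadow_extends_to_barCocone (S : Shadow B D) :
    ∃ (C : BarCocone B D) (h : C.C₀ = S.sh),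
      ∀ {X Y : B} (F : X ⟶ Y) (G : Y ⟶ X),
        (C.theta F G).hom =
          eqToHom (by rw [h]) ≫ (S.θ F G).hom ≫ eqToHom (by rw [h]) := by
  refine ⟨S.toBarCocone, rfl, fun F G => ?_⟩
  simp [BarCocone.theta, Shadow.toBarCocone, S.θ_inv]
  exact (Category.id_comp _).symm
end
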